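/- arXiv:1802.07702 — 8 statements merged into one kernel-verified Lean document; each statement's English description precedes it below -/
import Mathlib

section
/- Let f ∈ ℕ^{2n} be a partial switching flow (with respect to the origin o). Then f is a partial run profile of the run of the train from o to d if and only if f_{(d,s0(d))} = f_{(d,s1(d))} = 0 and one of the following two conditions holds: (1) the graph of last-used edges G*_f contains no directed cycle, or (2) G*_f contains exactly one directed cycle and this cycle contains the end-vertex v_f of f. -/
/-- One step of the train process: from a configuration (position, current switch
settings), the train moves along the current switch edge of its position and that
switch flips. `false` stands for the switch `s0`, `true` for `s1`. -/
def trainStep {V : Type} [DecidableEq V] (s : Bool → V → V) (st : V × (V → Bool)) :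
    V × (V → Bool) :=
  (s (st.2 st.1) st.1, Function.update st.2 st.1 (!(st.2 st.1)))

/-- Configuration (position, switch settings) of the run of the train from `o` to `d`
after `k` steps; the train starts at `o` with all switches set to `s0` and the process
stops when the train first reaches `d`. -/
def runState {V : Type} [DecidableEq V] (s : Bool → V → V) (o d : V) : ℕ → V × (V → Bool)
  | 0 => (o, fun _ => false)
  | k + 1 =>
      if (runState s o d k).1 = d then runState s o d k
      else trainStep s (runState s o d k)

/-- The partial run profile after `k` steps of the run of the train from `o` to `d`:
for each edge `(v, s b v)` (encoded by the pair `v`, `b`) the number of times the train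
has traversed it during the first `k` steps. -/
def runProfile {V : Type} [DecidableEq V] (s : Bool → V → V) (o d : V) : ℕ → V → Bool → ℕ
  | 0 => fun _ _ => 0
  | k + 1 =>
      if (runState s o d k).1 = d then runProfile s o d k
      else fun v b =>
        runProfile s o d k v b +
          if v = (runState s o d k).1 ∧ b = (runState s o d k).2 (runState s o d k).1
          then 1 else 0

/-- `f : V → Bool → ℕ` (where `f v b` is the value on the edge `(v, s b v)`) is a
switching flow from `o` to `v`: Kirchhoff's law and the parity condition hold. -/
def IsSwitchingFlow {V : Type} [Fintype V] [DecidableEq V] (s : Bool → V → V)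
    (o v : V) (f : V → Bool → ℕ) : Prop :=
  (∀ u : V,
      ((∑ w : V, ∑ b : Bool, if s b w = u then (f w b : ℤ) else 0)
          - ((f u false : ℤ) + (f u true : ℤ)))
        = (if u = v then 1 else 0) - (if u = o then 1 else 0)) ∧
  (∀ u : V, f u true ≤ f u false ∧ f u false ≤ f u true + 1)

/-- The edge `(v, s b v)` belongs to the graph of last-used edges `G*_f`. -/
def LastUsed {V : Type} (f : V → Bool → ℕ) (v : V) (b : Bool) : Prop :=
  (b = false ∧ f v false ≠ f v true) ∨ (b = true ∧ f v false = f v true ∧ 0 < f v true)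

/-- Adjacency of the graph of last-used edges `G*_f`. -/
def GstarAdj {V : Type} (s : Bool → V → V) (f : V → Bool → ℕ) (u w : V) : Prop :=
  ∃ b : Bool, LastUsed f u b ∧ s b u = w

/-- `c` is a directed cycle of the binary relation `adj`: a nonempty list of pairwise
distinct vertices with `adj` holding along the list cyclically. -/
def IsCycle {V : Type} (adj : V → V → Prop) (c : List V) : Prop :=
  c ≠ [] ∧ c.Nodup ∧
    ∀ i : Fin c.length, adj (c.get i) (c.get ⟨(i.1 + 1) % c.length, Nat.mod_lt _ i.pos⟩)

section TrainRun

variable {V : Type}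

/-- The vector `f` with one more traversal of the edge `(w, s b w)`. -/
def addEdge [DecidableEq V] (f : V → Bool → ℕ) (w : V) (b : Bool) : V → Bool → ℕ :=
  fun v c => f v c + if v = w ∧ c = b then 1 else 0

/-- Every vertex left at least once reaches `v` along last-used edges. -/
def AllReach (s : Bool → V → V) (f : V → Bool → ℕ) (v : V) : Prop :=
  ∀ u, 0 < f u false → Relation.ReflTransGen (GstarAdj s f) u v

theorem LastUsed.unique {f : V → Bool → ℕ} {v : V} {a b : Bool}
    (ha : LastUsed f v a) (hb : LastUsed f v b) : a = b := by
  unfold LastUsed at ha hb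
  grind

theorem GstarAdj.rightUnique {s : Bool → V → V} {f : V → Bool → ℕ} :
    Relator.RightUnique (GstarAdj s f) := by
  rintro u _ _ ⟨a, ha, rfl⟩ ⟨b, hb, rfl⟩
  rw [ha.unique hb]

theorem LastUsed.pos {f : V → Bool → ℕ} {v : V} {b : Bool}
    (hp : f v true ≤ f v false ∧ f v false ≤ f v true + 1) (h : LastUsed f v b) :
    0 < f v b := by
  rcases h with ⟨rfl, h⟩ | ⟨rfl, -, h⟩ <;> omega

theorem LastUsed.pos_false {f : V → Bool → ℕ} {v : V} {b : Bool}
    (hp : f v true ≤ f v false ∧ f v false ≤ f v true + 1) (h : LastUsed f v b) :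
    0 < f v false := by
  rcases h with ⟨rfl, h⟩ | ⟨rfl, -, h⟩ <;> omega

theorem GstarAdj.pos_false {s : Bool → V → V} {f : V → Bool → ℕ} {u x : V}
    (hp : f u true ≤ f u false ∧ f u false ≤ f u true + 1) (h : GstarAdj s f u x) :
    0 < f u false := by
  obtain ⟨b, hb, -⟩ := h
  exact hb.pos_false hp

theorem exists_lastUsed {f : V → Bool → ℕ} {v : V} (h : 0 < f v false) :
    ∃ b, LastUsed f v b := by
  by_cases hv : f v false = f v true
  · exact ⟨true, Or.inr ⟨rfl, hv, by omega⟩⟩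
  · exact ⟨false, Or.inl ⟨rfl, hv⟩⟩

/-- A path to `w` survives any change of the edges leaving `w`. -/
theorem reflTransGen_congr_target {r r' : V → V → Prop} {u w : V}
    (h : ∀ x y, x ≠ w → r x y → r' x y) (hu : Relation.ReflTransGen r u w) :
    Relation.ReflTransGen r' u w := by
  induction hu using Relation.ReflTransGen.head_induction_on with
  | refl => exact .refl
  | @head a c hac _ ih =>
    by_cases ha : a = w
    · rw [ha]
    · exact .head (h _ _ ha hac) ih

theorem lastUsed_congr {f g : V → Bool → ℕ} {x : V} (h : f x = g x) (b : Bool) :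
    LastUsed f x b ↔ LastUsed g x b := by
  simp only [LastUsed, h]

theorem gstarAdj_congr {s : Bool → V → V} {f g : V → Bool → ℕ} {x : V} (h : f x = g x) (y : V) :
    GstarAdj s f x y ↔ GstarAdj s g x y := by
  simp only [GstarAdj, lastUsed_congr h]

section AddEdge

variable [DecidableEq V]

theorem addEdge_of_ne (f : V → Bool → ℕ) {x w : V} (b : Bool) (h : x ≠ w) :
    addEdge f w b x = f x := by
  funext c
  simp [addEdge, h]

/-- If the switch at `w` points along `b`, then after the traversal `b` is the last-used
edge at `w`. -/
theorem lastUsed_addEdge {f : V → Bool → ℕ} {w : V} {b : Bool}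
    (hp : f w true ≤ f w false ∧ f w false ≤ f w true + 1)
    (hb : b = decide (f w false ≠ f w true)) : LastUsed (addEdge f w b) w b := by
  cases b <;> simp [LastUsed, addEdge] at hb ⊢ <;> omega

theorem switch_addEdge {f : V → Bool → ℕ} {w : V} {b : Bool}
    (hp : f w true ≤ f w false ∧ f w false ≤ f w true + 1)
    (hb : b = decide (f w false ≠ f w true)) :
    (!b) = decide (addEdge f w b w false ≠ addEdge f w b w true) := by
  cases b <;> simp [addEdge] at hb ⊢ <;> omega

theorem AllReach.addEdge {s : Bool → V → V} {f : V → Bool → ℕ} {w : V} {b : Bool}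
    (hp : f w true ≤ f w false ∧ f w false ≤ f w true + 1)
    (hb : b = decide (f w false ≠ f w true)) (h : AllReach s f w) :
    AllReach s (addEdge f w b) (s b w) := by
  intro u hu
  have hw : GstarAdj s (_root_.addEdge f w b) w (s b w) := ⟨b, lastUsed_addEdge hp hb, rfl⟩
  by_cases huw : u = w
  · rw [huw]
    exact .single hw
  · rw [addEdge_of_ne f b huw] at hu
    exact (reflTransGen_congr_target
      (fun x y hx => (gstarAdj_congr (addEdge_of_ne f b hx) y).2) (h u hu)).tail hw

theorem parity_addEdge {f : V → Bool → ℕ} {w : V} {b : Bool}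
    (hb : b = decide (f w false ≠ f w true))
    (hp : ∀ u, f u true ≤ f u false ∧ f u false ≤ f u true + 1) (u : V) :
    addEdge f w b u true ≤ addEdge f w b u false ∧
      addEdge f w b u false ≤ addEdge f w b u true + 1 := by
  have := hp u
  by_cases huw : u = w
  · subst huw
    cases b <;> simp [addEdge] at hb ⊢ <;> omega
  · rwa [addEdge_of_ne f b huw]

/-- Undoing the traversal of a last-used edge. -/
theorem exists_addEdge_eq {f : V → Bool → ℕ} {w : V} {b : Bool}
    (hp : ∀ u, f u true ≤ f u false ∧ f u false ≤ f u true + 1) (h : LastUsed f w b) :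
    ∃ g : V → Bool → ℕ, f = addEdge g w b ∧ b = decide (g w false ≠ g w true) ∧
      ∀ u, g u true ≤ g u false ∧ g u false ≤ g u true + 1 := by
  refine ⟨fun v c => f v c - if v = w ∧ c = b then 1 else 0, ?_, ?_, ?_⟩
  · funext v c
    have := h.pos (hp w)
    simp only [addEdge]
    split_ifs with hvc
    · obtain ⟨rfl, rfl⟩ := hvc
      omega
    · omega
  · have := hp w
    rcases h with ⟨rfl, h⟩ | ⟨rfl, h⟩ <;> simp <;> omega
  · intro u
    have := hp u
    by_cases huw : u = w
    · subst huw
      rcases h with ⟨rfl, h⟩ | ⟨rfl, h⟩ <;> simp <;> omega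
    · simpa [huw] using this

theorem outflow_addEdge (f : V → Bool → ℕ) (w : V) (b : Bool) (u : V) :
    ((addEdge f w b u false : ℤ) + addEdge f w b u true) =
      ((f u false : ℤ) + f u true) + if u = w then 1 else 0 := by
  by_cases h : u = w <;> cases b <;> simp [addEdge, h] <;> ring

variable [Fintype V]

theorem inflow_addEdge (s : Bool → V → V) (f : V → Bool → ℕ) (w : V) (b : Bool) (u : V) :
    (∑ x : V, ∑ c : Bool, if s c x = u then (addEdge f w b x c : ℤ) else 0) =
      (∑ x : V, ∑ c : Bool, if s c x = u then (f x c : ℤ) else 0) +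
        if s b w = u then 1 else 0 := by
  have h : ∀ x c, (if s c x = u then (addEdge f w b x c : ℤ) else 0) =
      (if s c x = u then (f x c : ℤ) else 0) +
        if c = b then (if x = w then (if s b w = u then 1 else 0) else 0) else 0 := by
    intro x c
    simp only [addEdge]
    grind
  simp only [h, Finset.sum_add_distrib, Finset.sum_ite_eq', Finset.mem_univ, if_true]

theorem isSwitchingFlow_addEdge_iff {s : Bool → V → V} {o w : V} {f : V → Bool → ℕ} {b : Bool}
    (hb : b = decide (f w false ≠ f w true))
    (hp : ∀ u, f u true ≤ f u false ∧ f u false ≤ f u true + 1) :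
    IsSwitchingFlow s o (s b w) (addEdge f w b) ↔ IsSwitchingFlow s o w f := by
  unfold IsSwitchingFlow
  rw [iff_true_intro hp, iff_true_intro (parity_addEdge hb hp), and_true, and_true]
  refine forall_congr' fun u => ?_
  simp only [inflow_addEdge, outflow_addEdge, eq_comm (a := s b w)]
  constructor <;> intro h <;> linarith

theorem sum_addEdge (f : V → Bool → ℕ) (w : V) (b : Bool) :
    ∑ x, ∑ c, addEdge f w b x c = ∑ x, ∑ c, f x c + 1 := by
  have h : ∀ x c, addEdge f w b x c = f x c + if c = b then (if x = w then 1 else 0) else 0 := by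
    intro x c
    simp only [addEdge]
    grind
  simp only [h, Finset.sum_add_distrib, Finset.sum_ite_eq', Finset.mem_univ, if_true]

end AddEdge

section Flow

variable [Fintype V] [DecidableEq V] {s : Bool → V → V} {o : V} {f : V → Bool → ℕ}

theorem IsSwitchingFlow.endVertex_unique {v v' : V} (h : IsSwitchingFlow s o v f)
    (h' : IsSwitchingFlow s o v' f) : v = v' := by
  have h1 := h.1 v
  rw [h'.1 v] at h1
  by_contra hne
  rw [if_pos rfl, if_neg hne] at h1
  linarith

theorem IsSwitchingFlow.zero : IsSwitchingFlow s o o (fun _ _ => 0) :=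
  ⟨fun u => by simp, fun u => by simp⟩

theorem le_inflow (s : Bool → V → V) (f : V → Bool → ℕ) (x : V) (b : Bool) :
    (f x b : ℤ) ≤ ∑ y : V, ∑ c : Bool, if s c y = s b x then (f y c : ℤ) else 0 := by
  have h1 : ∀ y c, (0 : ℤ) ≤ if s c y = s b x then (f y c : ℤ) else 0 := by
    intro y c
    positivity
  calc (f x b : ℤ) = if s b x = s b x then (f x b : ℤ) else 0 := by simp
    _ ≤ ∑ c : Bool, if s c x = s b x then (f x c : ℤ) else 0 :=
      Finset.single_le_sum (fun c _ => h1 x c) (Finset.mem_univ b)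
    _ ≤ _ := Finset.single_le_sum
      (f := fun y => ∑ c : Bool, if s c y = s b x then (f y c : ℤ) else 0)
      (fun y _ => Finset.sum_nonneg fun c _ => h1 y c) (Finset.mem_univ x)

theorem add_le_inflow (s : Bool → V → V) (f : V → Bool → ℕ) {x y : V} {a b : Bool}
    (hxy : x ≠ y) (hs : s a x = s b y) :
    (f x a + f y b : ℤ) ≤ ∑ z : V, ∑ c : Bool, if s c z = s b y then (f z c : ℤ) else 0 := by
  have h1 : ∀ z c, (0 : ℤ) ≤ if s c z = s b y then (f z c : ℤ) else 0 := by
    intro z c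
    positivity
  have h2 : ∀ z c, s c z = s b y →
      (f z c : ℤ) ≤ ∑ c : Bool, if s c z = s b y then (f z c : ℤ) else 0 := by
    intro z c hz
    calc (f z c : ℤ) = if s c z = s b y then (f z c : ℤ) else 0 := by simp [hz]
      _ ≤ _ := Finset.single_le_sum (f := fun c => if s c z = s b y then (f z c : ℤ) else 0)
        (fun c _ => h1 z c) (Finset.mem_univ c)
  calc (f x a + f y b : ℤ) ≤ _ := add_le_add (h2 x a hs) (h2 y b rfl)
    _ = ∑ z ∈ {x, y}, ∑ c : Bool, if s c z = s b y then (f z c : ℤ) else 0 :=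
      (Finset.sum_pair
        (f := fun z => ∑ c : Bool, if s c z = s b y then (f z c : ℤ) else 0) hxy).symm
    _ ≤ _ := Finset.sum_le_sum_of_subset_of_nonneg (Finset.subset_univ _)
      fun z _ _ => Finset.sum_nonneg fun c _ => h1 z c

/-- A last-used edge leads to the end-vertex or to a vertex that was left. -/
theorem IsSwitchingFlow.pos_of_adj {v x y : V} (hf : IsSwitchingFlow s o v f)
    (h : GstarAdj s f x y) (hy : y ≠ v) : 0 < f y false := by
  obtain ⟨b, hb, rfl⟩ := h
  have h1 := le_inflow s f x b
  have h2 := hb.pos (hf.2 x)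
  have h3 := hf.1 (s b x)
  have h4 := hf.2 (s b x)
  rw [if_neg hy] at h3
  split_ifs at h3 <;> omega

/-- A nonzero flow all of whose left vertices reach the end-vertex has a last-used edge
into the end-vertex whose tail is reached by all of them. -/
theorem IsSwitchingFlow.exists_pred {v : V} (hf : IsSwitchingFlow s o v f)
    (hr : AllReach s f v) {u : V} (hu : 0 < f u false) :
    ∃ w, GstarAdj s f w v ∧ AllReach s f w := by
  by_cases hv : 0 < f v false
  · obtain ⟨b, hb⟩ := exists_lastUsed hv
    have hadj : GstarAdj s f v (s b v) := ⟨b, hb, rfl⟩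
    have hx : Relation.ReflTransGen (GstarAdj s f) (s b v) v := by
      by_cases hsv : s b v = v
      · rw [hsv]
      · exact hr _ (hf.pos_of_adj hadj hsv)
    obtain hx | ⟨w, hw, hwv⟩ := hx.cases_tail
    · rw [← hx] at hadj
      exact ⟨v, hadj, hr⟩
    · exact ⟨w, hwv, fun z hz => ((hr z hz).tail hadj).trans hw⟩
  · have key : ∀ z, 0 < f z false →
        ∃ w, Relation.ReflTransGen (GstarAdj s f) z w ∧ GstarAdj s f w v := by
      intro z hz
      obtain rfl | h := (hr z hz).cases_tail
      · exact absurd hz hv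
      · exact h
    obtain ⟨w, -, hwv⟩ := key u hu
    refine ⟨w, hwv, fun z hz => ?_⟩
    obtain ⟨w', hzw, hwv'⟩ := key z hz
    have : w' = w := by
      by_contra hne
      obtain ⟨a, ha, hav⟩ := hwv'
      obtain ⟨b, hb, rfl⟩ := hwv
      have h1 := add_le_inflow s f hne hav
      have h2 := ha.pos (hf.2 _)
      have h3 := hb.pos (hf.2 _)
      have h4 := hf.1 (s b w)
      have h5 := hf.2 (s b w)
      split_ifs at h4 <;> omega
    rwa [← this]

end Flow

section Cycles

theorem IsCycle.mem_of_adj {r : V → V → Prop} (hr : Relator.RightUnique r)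
    {c : List V} (hc : IsCycle r c) {x y : V} (hx : x ∈ c) (h : r x y) : y ∈ c := by
  obtain ⟨i, rfl⟩ := List.mem_iff_get.1 hx
  rw [hr h (hc.2.2 i)]
  exact List.get_mem _ _

theorem IsCycle.mem_of_reflTransGen {r : V → V → Prop} (hr : Relator.RightUnique r)
    {c : List V} (hc : IsCycle r c) {x y : V} (hx : x ∈ c) (h : Relation.ReflTransGen r x y) :
    y ∈ c := by
  induction h with
  | refl => exact hx
  | tail _ h ih => exact hc.mem_of_adj hr ih h

theorem IsCycle.reflTransGen {r : V → V → Prop} {c : List V} (hc : IsCycle r c) {x y : V}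
    (hx : x ∈ c) (hy : y ∈ c) : Relation.ReflTransGen r x y := by
  obtain ⟨i, rfl⟩ := List.mem_iff_get.1 hx
  obtain ⟨j, rfl⟩ := List.mem_iff_get.1 hy
  have key : ∀ n : ℕ, Relation.ReflTransGen r (c.get i)
      (c.get ⟨(i.1 + n) % c.length, Nat.mod_lt _ i.pos⟩) := by
    intro n
    induction n with
    | zero => simp [Nat.mod_eq_of_lt i.2, Relation.ReflTransGen.refl]
    | succ n ih =>
      have h := hc.2.2 ⟨(i.1 + n) % c.length, Nat.mod_lt _ i.pos⟩
      simp only [Nat.mod_add_mod, add_assoc] at h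
      exact ih.tail h
  have h := key (c.length - i.1 + j.1)
  have hi := i.2
  have : (i.1 + (c.length - i.1 + j.1)) % c.length = j.1 := by
    rw [show i.1 + (c.length - i.1 + j.1) = c.length + j.1 by omega, Nat.add_mod_left,
      Nat.mod_eq_of_lt j.2]
  simpa only [this] using h

/-- If every element of a nonempty subset of a finite type has a successor in the subset,
then the relation has a cycle inside the subset. -/
theorem exists_isCycle [Finite V] {r : V → V → Prop} {P : V → Prop}
    (h : ∀ x, P x → ∃ y, r x y ∧ P y) {u : V} (hu : P u) :
    ∃ c : List V, IsCycle r c ∧ ∀ x ∈ c, P x := by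
  have h' : ∀ x, ∃ y, P x → r x y ∧ P y := by
    intro x
    by_cases hx : P x
    · obtain ⟨y, hy⟩ := h x hx
      exact ⟨y, fun _ => hy⟩
    · exact ⟨x, fun hx' => absurd hx' hx⟩
  choose g hg using h'
  have hP : ∀ x, P x → ∀ n, P (g^[n] x) := by
    intro x hx n
    induction n with
    | zero => exact hx
    | succ n ih =>
      rw [Function.iterate_succ_apply']
      exact (hg _ ih).2
  obtain ⟨m, n, hmn, heq⟩ : ∃ m n : ℕ, m < n ∧ g^[m] u = g^[n] u := by
    obtain ⟨m, n, hne, heq⟩ := Finite.exists_ne_map_eq_of_infinite fun n : ℕ => g^[n] u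
    rcases lt_or_gt_of_ne hne with hlt | hlt
    · exact ⟨m, n, hlt, heq⟩
    · exact ⟨n, m, hlt, heq.symm⟩
  set z := g^[m] u with hz
  have hPz : P z := hP u hu m
  have hper : z ∈ Function.periodicPts g := by
    refine ⟨n - m, by omega, ?_⟩
    rw [Function.IsPeriodicPt, Function.IsFixedPt, hz, ← Function.iterate_add_apply,
      Nat.sub_add_cancel hmn.le, ← heq]
  have hpos := Function.minimalPeriod_pos_of_mem_periodicPts hper
  refine ⟨(List.range (Function.minimalPeriod g z)).map (g^[·] z), ⟨?_, ?_, ?_⟩, ?_⟩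
  · simpa using hpos.ne'
  · refine List.Nodup.map_on (fun a ha b hb hab => ?_) List.nodup_range
    rw [List.mem_range] at ha hb
    exact (Function.iterate_eq_iterate_iff_of_lt_minimalPeriod ha hb).1 hab
  · intro i
    simp only [List.get_eq_getElem, List.getElem_map, List.getElem_range, List.length_map,
      List.length_range, Function.iterate_mod_minimalPeriod_eq, Function.iterate_succ_apply']
    exact (hg _ (hP z hPz _)).1
  · intro x hx
    obtain ⟨k, -, rfl⟩ := List.mem_map.1 hx
    exact hP z hPz k

variable [DecidableEq V] {s : Bool → V → V} {o v : V} {f : V → Bool → ℕ}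

theorem IsSwitchingFlow.allReach_iff [Fintype V] (hf : IsSwitchingFlow s o v f) :
    AllReach s f v ↔ ∀ c : List V, IsCycle (GstarAdj s f) c → v ∈ c := by
  constructor
  · intro hr c hc
    obtain ⟨x, hx⟩ := List.exists_mem_of_ne_nil c hc.1
    obtain ⟨i, hi⟩ := List.mem_iff_get.1 hx
    exact hc.mem_of_reflTransGen GstarAdj.rightUnique hx
      (hr x (hi ▸ (hc.2.2 i).pos_false (hf.2 _)))
  · intro hc u hu
    by_contra hnot
    obtain ⟨c, hcyc, hmem⟩ := exists_isCycle (r := GstarAdj s f)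
      (P := fun x => 0 < f x false ∧ ¬ Relation.ReflTransGen (GstarAdj s f) x v)
      (fun x ⟨hx, hxv⟩ => by
        obtain ⟨b, hb⟩ := exists_lastUsed hx
        have hadj : GstarAdj s f x (s b x) := ⟨b, hb, rfl⟩
        have hyv : ¬ Relation.ReflTransGen (GstarAdj s f) (s b x) v :=
          fun h => hxv (.head hadj h)
        exact ⟨s b x, hadj, hf.pos_of_adj hadj fun h => hyv (h ▸ .refl), hyv⟩)
      ⟨hu, hnot⟩
    exact (hmem v (hc c hcyc)).2 .refl

theorem forall_isCycle_mem_iff :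
    (∀ c : List V, IsCycle (GstarAdj s f) c → v ∈ c) ↔
      ((∀ c : List V, ¬ IsCycle (GstarAdj s f) c) ∨
        ((∃ c : List V, IsCycle (GstarAdj s f) c ∧ v ∈ c) ∧
          ∀ c₁ c₂ : List V, IsCycle (GstarAdj s f) c₁ → IsCycle (GstarAdj s f) c₂ →
            c₁.toFinset = c₂.toFinset)) := by
  constructor
  · intro h
    by_cases hex : ∃ c : List V, IsCycle (GstarAdj s f) c
    · obtain ⟨c, hc⟩ := hex
      refine Or.inr ⟨⟨c, hc, h c hc⟩, fun c₁ c₂ h₁ h₂ => ?_⟩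
      ext x
      rw [List.mem_toFinset, List.mem_toFinset]
      exact ⟨fun hx => h₂.mem_of_reflTransGen GstarAdj.rightUnique (h c₂ h₂)
          (h₁.reflTransGen (h c₁ h₁) hx),
        fun hx => h₁.mem_of_reflTransGen GstarAdj.rightUnique (h c₁ h₁)
          (h₂.reflTransGen (h c₂ h₂) hx)⟩
    · exact Or.inl (not_exists.1 hex)
  · rintro (h | ⟨⟨c, hc, hv⟩, h⟩) c' hc'
    · exact absurd hc' (h c')
    · rwa [← List.mem_toFinset, h c' c hc' hc, List.mem_toFinset]

end Cycles

section Run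

variable [DecidableEq V]

theorem runProfile_succ_of_ne {s : Bool → V → V} {o d : V} {k : ℕ}
    (h : (runState s o d k).1 ≠ d) :
    runProfile s o d (k + 1) = addEdge (runProfile s o d k) (runState s o d k).1
      ((runState s o d k).2 (runState s o d k).1) := by
  funext v b
  simp [runProfile, h, addEdge]

variable [Fintype V]

theorem runProfile_invariant (s : Bool → V → V) (o d : V) (k : ℕ) :
    IsSwitchingFlow s o (runState s o d k).1 (runProfile s o d k) ∧
      (∀ u, (runState s o d k).2 u =
        decide (runProfile s o d k u false ≠ runProfile s o d k u true)) ∧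
      AllReach s (runProfile s o d k) (runState s o d k).1 ∧
      ∀ b, runProfile s o d k d b = 0 := by
  induction k with
  | zero =>
    exact ⟨IsSwitchingFlow.zero, fun u => by simp [runState, runProfile],
      fun u hu => by simp [runProfile] at hu, fun b => rfl⟩
  | succ k ih =>
    by_cases h : (runState s o d k).1 = d
    · rwa [runState, runProfile, if_pos h, if_pos h]
    · rw [runProfile_succ_of_ne h, runState, if_neg h]
      obtain ⟨hf, hsw, hr, hd⟩ := ih
      generalize runState s o d k = st at h hf hsw hr ⊢
      obtain ⟨w, σ⟩ := st
      simp only [trainStep] at h hf hsw hr ⊢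
      have hb := hsw w
      refine ⟨(isSwitchingFlow_addEdge_iff hb hf.2).2 hf, fun u => ?_,
        hr.addEdge (hf.2 _) hb, fun b => ?_⟩
      · by_cases huw : u = w
        · subst huw
          rw [Function.update_self]
          exact switch_addEdge (hf.2 u) hb
        · rw [addEdge_of_ne _ _ huw, Function.update_of_ne huw, hsw]
      · rw [addEdge_of_ne _ _ (Ne.symm h), hd]

theorem exists_eq_runProfile {s : Bool → V → V} {o d : V} (n : ℕ) :
    ∀ (f : V → Bool → ℕ) (v : V), ∑ x, ∑ c, f x c = n → IsSwitchingFlow s o v f →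
      AllReach s f v → (∀ b, f d b = 0) → ∃ k, f = runProfile s o d k := by
  induction n with
  | zero =>
    intro f v hn _ _ _
    refine ⟨0, ?_⟩
    funext x c
    simp only [Finset.sum_eq_zero_iff, Finset.mem_univ, true_imp_iff] at hn
    exact hn x c
  | succ n ih =>
    intro f v hn hf hr hd
    obtain ⟨u, hu⟩ : ∃ u, 0 < f u false := by
      by_contra! hzero
      have : ∀ x c, f x c = 0 := by
        intro x c
        have := hzero x
        have := hf.2 x
        cases c <;> omega
      simp [this] at hn
    obtain ⟨w, ⟨b, hb, rfl⟩, hrw⟩ := hf.exists_pred hr hu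
    have hwd : w ≠ d := by
      rintro rfl
      exact (hb.pos (hf.2 w)).ne' (hd b)
    obtain ⟨g, rfl, hgb, hgp⟩ := exists_addEdge_eq hf.2 hb
    have hg := (isSwitchingFlow_addEdge_iff hgb hgp).1 hf
    have hgr : AllReach s g w := by
      intro x hx
      exact reflTransGen_congr_target
        (fun y z hy => (gstarAdj_congr (addEdge_of_ne g b hy) z).1)
        (hrw x (by unfold addEdge; omega))
    rw [sum_addEdge, Nat.add_right_cancel_iff] at hn
    obtain ⟨k, rfl⟩ := ih g w hn hg hgr fun c => by rw [← hd c, addEdge_of_ne g b hwd.symm]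
    obtain ⟨hk, hsw, -⟩ := runProfile_invariant s o d k
    obtain rfl := hg.endVertex_unique hk
    exact ⟨k + 1, by rw [runProfile_succ_of_ne hwd, hsw, ← hgb]⟩

end Run

end TrainRun


/-- A partial switching flow `f` (with respect to the origin `o`, with
end-vertex `vf`) is a partial run profile of the run of the train from `o` to `d` iff
`f` vanishes on both outgoing edges of `d` and either `G*_f` contains no directed cycle,
or `G*_f` contains exactly one directed cycle (up to rotation) and this cycle contains
the end-vertex `vf`. -/
theorem partial_run_profile_characterization
    {V : Type} [Fintype V] [DecidableEq V] (s : Bool → V → V) (o d : V)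
    (hd0 : s false d = d) (hd1 : s true d = d)
    (f : V → Bool → ℕ) (vf : V) (hf : IsSwitchingFlow s o vf f) :
    (∃ k : ℕ, f = runProfile s o d k) ↔
      (f d false = 0 ∧ f d true = 0 ∧
        ((∀ c : List V, ¬ IsCycle (GstarAdj s f) c) ∨
          ((∃ c : List V, IsCycle (GstarAdj s f) c ∧ vf ∈ c) ∧
            ∀ c₁ c₂ : List V, IsCycle (GstarAdj s f) c₁ → IsCycle (GstarAdj s f) c₂ →
              c₁.toFinset = c₂.toFinset))) := by
  rw [← forall_isCycle_mem_iff, ← hf.allReach_iff]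
  constructor
  · rintro ⟨k, rfl⟩
    obtain ⟨hk, -, hr, hd⟩ := runProfile_invariant s o d k
    obtain rfl := hf.endVertex_unique hk
    exact ⟨hd false, hd true, hr⟩
  · rintro ⟨h0, h1, hr⟩
    exact exists_eq_runProfile _ f vf rfl hf hr fun b => by cases b <;> assumption
end

section
/- For every k ≥ 0, if r is the partial run profile after k steps of the run of the train from o to d, then the graph of last-used edges G*_r contains at most one directed cycle, and if G*_r contains a directed cycle then this cycle contains the end-vertex v_r. -/
theorem IsCycle.exists_adj {V : Type} {adj : V → V → Prop} {c : List V} (hc : IsCycle adj c)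
    {u : V} (hu : u ∈ c) : ∃ w ∈ c, adj u w := by
  obtain ⟨i, rfl⟩ := List.get_of_mem hu
  exact ⟨_, List.get_mem _ _, hc.2.2 i⟩

/-- A set containing a vertex of a cycle and closed under adjacency contains the cycle. -/
theorem IsCycle.forall_mem_of_closed {V : Type} {adj : V → V → Prop} {c : List V}
    (hc : IsCycle adj c) {S : Set V} (hS : ∀ u w, u ∈ S → adj u w → w ∈ S)
    {p : V} (hp : p ∈ c) (hpS : p ∈ S) : ∀ v ∈ c, v ∈ S := by
  obtain ⟨i, rfl⟩ := List.get_of_mem hp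
  have hpos : 0 < c.length := i.pos
  have key : ∀ m : ℕ, c.get ⟨(i.1 + m) % c.length, Nat.mod_lt _ hpos⟩ ∈ S := by
    intro m
    induction m with
    | zero => simpa [Nat.mod_eq_of_lt i.2] using hpS
    | succ m ih =>
      have h := hS _ _ ih (hc.2.2 _)
      simpa [← add_assoc] using h
  intro v hv
  obtain ⟨j, rfl⟩ := List.get_of_mem hv
  have h := key (c.length - i.1 + j.1)
  have e : (i.1 + (c.length - i.1 + j.1)) % c.length = j.1 := by
    have : i.1 + (c.length - i.1 + j.1) = c.length + j.1 := by omega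
    rw [this, Nat.add_mod_left, Nat.mod_eq_of_lt j.2]
  simpa only [e] using h

/-- If `adj` strictly increases `t` except when it leads to `p`, every cycle contains `p`. -/
theorem IsCycle.mem_of_rank {V : Type} {adj : V → V → Prop} {c : List V} (hc : IsCycle adj c)
    {p : V} (t : V → ℕ) (ht : ∀ u w, adj u w → w = p ∨ t u < t w) : p ∈ c := by
  classical
  obtain ⟨u, hu, hmax⟩ := c.toFinset.exists_max_image t (by simpa using hc.1)
  obtain ⟨w, hw, huw⟩ := hc.exists_adj (List.mem_toFinset.1 hu)
  rcases ht u w huw with rfl | hlt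
  · exact hw
  · exact absurd (hmax w (List.mem_toFinset.2 hw)) (not_le.2 hlt)

theorem GstarAdj.eq_of_adj {V : Type} {s : Bool → V → V} {f : V → Bool → ℕ} {u w w' : V}
    (h : GstarAdj s f u w) (h' : GstarAdj s f u w') : w = w' := by
  obtain ⟨b, hb, rfl⟩ := h
  obtain ⟨b', hb', rfl⟩ := h'
  have : b = b' := by
    unfold LastUsed at hb hb'
    grind
  rw [this]

/-- The current switch of `v` is `s0` exactly when both edges out of `v` were used equally often,
and otherwise `s0` was used once more. -/
theorem runProfile_false {V : Type} [DecidableEq V] (s : Bool → V → V) (o d : V) (k : ℕ) (v : V) :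
    runProfile s o d k v false =
      runProfile s o d k v true + if (runState s o d k).2 v then 1 else 0 := by
  induction k with
  | zero => simp [runProfile, runState]
  | succ k ih =>
    by_cases hd : (runState s o d k).1 = d
    · simpa only [runProfile, runState, if_pos hd] using ih
    · simp only [runProfile, runState, if_neg hd, trainStep]
      by_cases hv : v = (runState s o d k).1
      · subst hv
        cases hb : (runState s o d k).2 (runState s o d k).1 <;> simp [hb] at ih ⊢ <;> omega
      · simpa [hv] using ih

/-- The witness is the time (counted from one) at which the train last left a vertex. -/
theorem exists_rank_runProfile {V : Type} [DecidableEq V] (s : Bool → V → V) (o d : V) (k : ℕ) :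
    ∃ t : V → ℕ, (∀ v, t v ≤ k) ∧
      ∀ u w, GstarAdj s (runProfile s o d k) u w → w = (runState s o d k).1 ∨ t u < t w := by
  induction k with
  | zero => exact ⟨0, fun _ => le_rfl, by simp [GstarAdj, LastUsed, runProfile]⟩
  | succ k ih =>
    obtain ⟨t, hle, ht⟩ := ih
    by_cases hd : (runState s o d k).1 = d
    · refine ⟨t, fun v => (hle v).trans k.le_succ, ?_⟩
      simpa only [runProfile, runState, if_pos hd] using ht
    refine ⟨Function.update t (runState s o d k).1 (k + 1), fun v => ?_, ?_⟩
    · have := hle v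
      rw [Function.update_apply]
      split <;> omega
    rintro u w ⟨b, hb, rfl⟩
    by_cases hu : u = (runState s o d k).1
    · subst hu
      left
      have h := runProfile_false s o d k (runState s o d k).1
      have hb' : b = (runState s o d k).2 (runState s o d k).1 := by
        simp only [LastUsed, runProfile, if_neg hd] at hb
        cases hs : (runState s o d k).2 (runState s o d k).1 <;> simp [hs] at h hb ⊢ <;> grind
      simp [runState, if_neg hd, trainStep, hb']
    · right
      have hb' : LastUsed (runProfile s o d k) u b := by
        simpa [LastUsed, runProfile, if_neg hd, hu] using hb
      rw [Function.update_of_ne hu, Function.update_apply]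
      have := hle u
      split
      · omega
      · exact (ht u _ ⟨b, hb', rfl⟩).resolve_left ‹_›

/-- For every `k ≥ 0`, the graph of last-used edges of the partial run
profile after `k` steps contains at most one directed cycle (any two cycles have the
same vertex set, i.e. coincide up to rotation), and any such cycle contains the
end-vertex `(runState s o d k).1`. -/
theorem run_profile_at_most_one_cycle_through_end_vertex
    {V : Type} [Fintype V] [DecidableEq V] (s : Bool → V → V) (o d : V)
    (hd0 : s false d = d) (hd1 : s true d = d) (k : ℕ) :
    (∀ c₁ c₂ : List V, IsCycle (GstarAdj s (runProfile s o d k)) c₁ →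
        IsCycle (GstarAdj s (runProfile s o d k)) c₂ → c₁.toFinset = c₂.toFinset) ∧
    (∀ c : List V, IsCycle (GstarAdj s (runProfile s o d k)) c →
        (runState s o d k).1 ∈ c) := by
  obtain ⟨t, -, ht⟩ := exists_rank_runProfile s o d k
  have hmem : ∀ c, IsCycle (GstarAdj s (runProfile s o d k)) c → (runState s o d k).1 ∈ c :=
    fun c hc => hc.mem_of_rank t ht
  have hsub : ∀ c c', IsCycle (GstarAdj s (runProfile s o d k)) c →
      IsCycle (GstarAdj s (runProfile s o d k)) c' → ∀ v ∈ c, v ∈ c' := by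
    intro c c' hc hc'
    refine hc.forall_mem_of_closed (S := {v | v ∈ c'}) (fun u w hu huw => ?_) (hmem c hc)
      (hmem c' hc')
    obtain ⟨w', hw', huw'⟩ := hc'.exists_adj hu
    exact huw.eq_of_adj huw' ▸ hw'
  refine ⟨fun c₁ c₂ h₁ h₂ => ?_, hmem⟩
  ext v
  simpa using ⟨hsub c₁ c₂ h₁ h₂ v, hsub c₂ c₁ h₂ h₁ v⟩
end

section
/- Let f ∈ ℕ^{2n} be a partial switching flow (with respect to the origin o) with f_{(d,s0(d))} = f_{(d,s1(d))} = 0, let k* be the largest integer k such that the partial run profile after k steps of the run from o to d is componentwise at most f (such a maximal k* exists), and let r be the partial run profile after k* steps. Then f and r agree on both outgoing edges of the end-vertex v_r of r, i.e., f_{(v_r,s0(v_r))} = r_{(v_r,s0(v_r))} and f_{(v_r,s1(v_r))} = r_{(v_r,s1(v_r))}. -/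
theorem runProfile_mono {V : Type} [DecidableEq V] (s : Bool → V → V) (o d : V) :
    Monotone (runProfile s o d) := by
  refine monotone_nat_of_le_succ fun k v b => ?_
  rw [runProfile]
  split_ifs
  · exact le_rfl
  · exact Nat.le_add_right _ _

/-- The run never leaves the destination, so no edge out of `d` is traversed. -/
theorem runProfile_destination {V : Type} [DecidableEq V] (s : Bool → V → V) (o d : V)
    (k : ℕ) (b : Bool) : runProfile s o d k d b = 0 := by
  induction k with
  | zero => rfl
  | succ k ih =>
    rw [runProfile]
    split_ifs with h
    · exact ih
    · simp [ih, Ne.symm h]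

/-- The switch at `v` records whether the `s0`-edge has been used once more than the
`s1`-edge. -/
theorem runProfile_parity {V : Type} [DecidableEq V] (s : Bool → V → V) (o d : V)
    (k : ℕ) (v : V) :
    runProfile s o d k v false =
      runProfile s o d k v true + if (runState s o d k).2 v = true then 1 else 0 := by
  induction k with
  | zero => simp [runProfile, runState]
  | succ k ih =>
    rw [runProfile, runState]
    split_ifs with h h' h' <;> try simpa [h'] using ih
    all_goals
      by_cases hv : v = (runState s o d k).1
      · subst hv
        cases hb : (runState s o d k).2 (runState s o d k).1 <;>
          simp_all [trainStep]
      · simp_all [trainStep]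

/-- Every step taken before reaching the destination strictly increases the total number
of edge traversals. -/
theorem sum_runProfile_lt_succ {V : Type} [Fintype V] [DecidableEq V]
    (s : Bool → V → V) (o d : V) (k : ℕ) (h : (runState s o d k).1 ≠ d) :
    ∑ p : V × Bool, runProfile s o d k p.1 p.2 <
      ∑ p : V × Bool, runProfile s o d (k + 1) p.1 p.2 := by
  refine Finset.sum_lt_sum (fun p _ => runProfile_mono s o d k.le_succ p.1 p.2)
    ⟨((runState s o d k).1, (runState s o d k).2 (runState s o d k).1),
      Finset.mem_univ _, ?_⟩
  simp [runProfile, h]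


/-- Let `f` be a partial switching flow (w.r.t. the origin `o`, with
end-vertex `vf`) vanishing on both outgoing edges of `d`. Then there is a maximal
partial run profile `r = runProfile s o d k` of the run from `o` to `d` that is
componentwise at most `f`, and `f` and `r` agree on both outgoing edges of the
end-vertex `(runState s o d k).1` of `r`. -/
theorem flow_agrees_with_maximal_run_profile_at_its_end_vertex
    {V : Type} [Fintype V] [DecidableEq V] (s : Bool → V → V) (o d : V)
    (hd0 : s false d = d) (hd1 : s true d = d)
    (f : V → Bool → ℕ) (vf : V) (hf : IsSwitchingFlow s o vf f)
    (hfd0 : f d false = 0) (hfd1 : f d true = 0) :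
    ∃ k : ℕ,
      (∀ v b, runProfile s o d k v b ≤ f v b) ∧
      (∀ j : ℕ, (∀ v b, runProfile s o d j v b ≤ f v b) →
        ∀ v b, runProfile s o d j v b ≤ runProfile s o d k v b) ∧
      f (runState s o d k).1 false = runProfile s o d k (runState s o d k).1 false ∧
      f (runState s o d k).1 true = runProfile s o d k (runState s o d k).1 true := by
  classical
  let S : ℕ → ℕ := fun k => ∑ p : V × Bool, runProfile s o d k p.1 p.2
  let P : ℕ → Prop := fun n => ∃ k, (∀ v b, runProfile s o d k v b ≤ f v b) ∧ S k = n
  have hbound : ∀ n, P n → n ≤ ∑ p : V × Bool, f p.1 p.2 := by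
    rintro _ ⟨k, hk, rfl⟩
    exact Finset.sum_le_sum fun p _ => hk p.1 p.2
  have hP0 : P (S 0) := ⟨0, fun v b => Nat.zero_le _, rfl⟩
  obtain ⟨k, hk, hkS⟩ := Nat.findGreatest_spec (hbound _ hP0) hP0
  have hmax : ∀ j, (∀ v b, runProfile s o d j v b ≤ f v b) → S j ≤ S k := fun j hj =>
    hkS ▸ Nat.le_findGreatest (hbound _ ⟨j, hj, rfl⟩) ⟨j, hj, rfl⟩
  refine ⟨k, hk, fun j hj v b => ?_, ?_⟩
  · rcases le_total j k with hjk | hkj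
    · exact runProfile_mono s o d hjk v b
    · have hle : ∀ p ∈ (Finset.univ : Finset (V × Bool)),
          runProfile s o d k p.1 p.2 ≤ runProfile s o d j p.1 p.2 :=
        fun p _ => runProfile_mono s o d hkj p.1 p.2
      exact ((Finset.sum_eq_sum_iff_of_le hle).1
        (le_antisymm (Finset.sum_le_sum hle) (hmax j hj)) (v, b) (Finset.mem_univ _)).ge
  · by_cases hd : (runState s o d k).1 = d
    · simp [hd, runProfile_destination, hfd0, hfd1]
    · have hbad : ¬ ∀ v b, runProfile s o d (k + 1) v b ≤ f v b := fun h =>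
        (hmax _ h).not_gt (sum_runProfile_lt_succ s o d k hd)
      push Not at hbad
      obtain ⟨v, b, hvb⟩ := hbad
      rw [runProfile, if_neg hd] at hvb
      have hle := hk v b
      split_ifs at hvb with hc
      · obtain ⟨rfl, rfl⟩ := hc
        have hpar := runProfile_parity s o d k (runState s o d k).1
        have hf0 := hk (runState s o d k).1 false
        have hf1 := hk (runState s o d k).1 true
        have hfp := hf.2 (runState s o d k).1
        cases hb : (runState s o d k).2 (runState s o d k).1 <;>
          simp only [hb, if_true, Bool.false_eq_true, if_false] at hpar hvb <;> omega
      · omega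
end

section
/- If the run of the train from o to d terminates, then its run profile r satisfies r_e ≤ 2^n for every edge e ∈ E, where n = |V|. -/
section TrainRun

variable {V : Type} [DecidableEq V] (s : Bool → V → V) (o d : V)

/-- The destination is never left. -/
theorem runProfile_dest (k : ℕ) (b : Bool) : runProfile s o d k d b = 0 := by
  induction k with
  | zero => rfl
  | succ k ih =>
    rw [runProfile]
    split_ifs with h
    · exact ih
    · simp [ih, Ne.symm h]

/-- The switch at `v` records which of the two outgoing edges of `v` was used last. -/
theorem runProfile_false_eq (k : ℕ) (v : V) :
    runProfile s o d k v false
      = runProfile s o d k v true + ((runState s o d k).2 v).toNat := by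
  induction k with
  | zero => rfl
  | succ k ih =>
    rw [runProfile, runState]
    split_ifs with h
    · exact ih
    · by_cases hv : v = (runState s o d k).1
      · subst hv
        cases hb : (runState s o d k).2 (runState s o d k).1 <;>
          simp [trainStep, hb] at ih ⊢ <;> omega
      · simp [trainStep, hv, ih]

/-- An edge is traversed at most as often as its head is left, plus one if the train currently
stands at that head. -/
theorem runProfile_le_head (k : ℕ) (w : V) (b : Bool) :
    runProfile s o d k w b
      ≤ runProfile s o d k (s b w) false + runProfile s o d k (s b w) true
        + if s b w = (runState s o d k).1 then 1 else 0 := by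
  induction k with
  | zero => simp [runProfile]
  | succ k ih =>
    rw [runProfile, runState]
    split_ifs with h h' h'
    · simpa [h'] using ih
    · simpa [h'] using ih
    all_goals
      generalize hp : (runState s o d k).1 = p at *
      generalize hc : (runState s o d k).2 = c at *
      simp only [trainStep, hp, hc] at h' ⊢
      generalize hu : s b w = u at *
      rcases hcp : c p <;> grind

/-- A set of vertices closed under predecessors which contains the current position contains
every vertex that was left so far. -/
theorem mem_of_runProfile_pos (A : Set V) (hA : ∀ w b, s b w ∈ A → w ∈ A) (k : ℕ)
    (hk : (runState s o d k).1 ∈ A) (u : V) (b : Bool) (hu : 0 < runProfile s o d k u b) :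
    u ∈ A := by
  induction k with
  | zero => simp [runProfile] at hu
  | succ k ih =>
    rw [runProfile] at hu
    rw [runState] at hk
    split_ifs at hu hk with h
    · exact ih hk hu
    · have hp := hA _ _ hk
      by_cases hup : u = (runState s o d k).1
      · rwa [hup]
      · exact ih hp (by simpa [hup] using hu)

variable [Fintype V]

/-- After termination, at least `i + 1` vertices were left fewer than `2 ^ (i + 1)` times, as
long as there are that many vertices. -/
theorem card_left_lt_two_pow (k : ℕ) (hterm : (runState s o d k).1 = d) (i : ℕ)
    (hi : i + 1 ≤ Fintype.card V) :
    i + 1 ≤ (Finset.univ.filter fun u =>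
      runProfile s o d k u false + runProfile s o d k u true < 2 ^ (i + 1)).card := by
  have hd (j : ℕ) : runProfile s o d k d false + runProfile s o d k d true < 2 ^ (j + 1) := by
    simp [runProfile_dest]
  induction i with
  | zero => exact Finset.card_pos.2 ⟨d, by simpa using hd 0⟩
  | succ i ih =>
    have ih := ih (by omega)
    have hmono (u : V)
        (h : runProfile s o d k u false + runProfile s o d k u true < 2 ^ (i + 1)) :
        runProfile s o d k u false + runProfile s o d k u true < 2 ^ (i + 1 + 1) :=
      h.trans (Nat.pow_lt_pow_right (by norm_num) (by omega))
    by_cases hA : ∀ w b,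
        runProfile s o d k (s b w) false + runProfile s o d k (s b w) true < 2 ^ (i + 1) →
        runProfile s o d k w false + runProfile s o d k w true < 2 ^ (i + 1)
    · have hall (u : V) :
          runProfile s o d k u false + runProfile s o d k u true < 2 ^ (i + 1) := by
        have hmem := mem_of_runProfile_pos s o d
          {u | runProfile s o d k u false + runProfile s o d k u true < 2 ^ (i + 1)} hA k
          (by rw [hterm]; exact hd i) u
        by_contra hu
        have hpos : 0 < 2 ^ (i + 1) := by positivity
        rcases Nat.eq_zero_or_pos (runProfile s o d k u false) with h0 | h0
        · exact hu (hmem true (by omega))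
        · exact hu (hmem false h0)
      rw [Finset.filter_true_of_mem fun u _ => hmono u (hall u)]
      exact hi
    · push Not at hA
      obtain ⟨w, b, hhead, hw⟩ := hA
      refine Nat.succ_le_of_lt (ih.trans_lt (Finset.card_lt_card ?_))
      refine (Finset.ssubset_iff_of_subset fun u hu => ?_).2 ⟨w, ?_, ?_⟩
      · simp only [Finset.mem_filter_univ] at hu ⊢
        exact hmono u hu
      · rw [Finset.mem_filter_univ]
        have hedge : runProfile s o d k w b < 2 ^ (i + 1) := by
          have hle := runProfile_le_head s o d k w b
          rw [hterm] at hle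
          split_ifs at hle with hwd
          · rw [hwd, runProfile_dest, runProfile_dest] at hle
            exact hle.trans_lt (Nat.one_lt_two_pow (by omega))
          · exact hle.trans_lt hhead
        have hpar := runProfile_false_eq s o d k w
        have htog := Bool.toNat_le ((runState s o d k).2 w)
        rw [pow_succ]
        cases b <;> omega
      · rw [Finset.mem_filter_univ]
        exact hw.not_gt

end TrainRun

/-- If the run of the train from `o` to `d` terminates, then its run
profile `r` satisfies `r e ≤ 2 ^ n` for every edge `e`, where `n = |V|`. -/
theorem run_profile_le_two_pow_card
    {V : Type} [Fintype V] [DecidableEq V] (s : Bool → V → V) (o d : V)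
    (hd0 : s false d = d) (hd1 : s true d = d)
    (k : ℕ) (hterm : (runState s o d k).1 = d) :
    ∀ (v : V) (b : Bool), runProfile s o d k v b ≤ 2 ^ Fintype.card V := by
  intro v b
  have hpos : 0 < Fintype.card V := Fintype.card_pos_iff.2 ⟨d⟩
  have hcard := card_left_lt_two_pow s o d k hterm (Fintype.card V - 1) (by omega)
  rw [Nat.sub_add_cancel hpos] at hcard
  have huniv := Finset.eq_univ_of_card _ (le_antisymm (Finset.card_le_univ _) hcard)
  have hv := (Finset.mem_filter_univ v).1 (huniv ▸ Finset.mem_univ v)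
  cases b <;> omega
end

section
/- Let (G,o,d,d̄) be an S-Arrival instance with n = |V|, and set V' = V∖{d,d̄}. Fix any t ∈ V and any p ∈ {0,1}^{V'}. Then there exists exactly one vector f ∈ ℝ^{2(n−2)}, indexed by the edges (v,s0(v)) and (v,s1(v)) with v ∈ V', such that: (Kirchhoff's law) for every v ∈ V', the sum of f over all edges (u,w) with u ∈ V' and w = v, minus f_{(v,s0(v))} + f_{(v,s1(v))} subtracted (i.e., minus the total f on the two edges leaving v), equals [v=t] − [v=o], where [·] is 1 if the condition holds and 0 otherwise; and (parity condition) for every v ∈ V', f_{(v,s0(v))} − f_{(v,s1(v))} = p_v. -/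
/-- Maximum principle: a function whose value at each vertex is the mean of its values at the
two successors, and which vanishes at `d` and `dbar`, is nonpositive when every vertex reaches
`d` or `dbar`. -/
theorem nonpos_of_mean_of_reach {V : Type} [Fintype V] (s : Bool → V → V) (d dbar : V)
    (hreach : ∀ v : V,
      Relation.ReflTransGen (fun u w : V => s false u = w ∨ s true u = w) v d ∨
      Relation.ReflTransGen (fun u w : V => s false u = w ∨ s true u = w) v dbar)
    (g : V → ℝ) (hd : g d = 0) (hb : g dbar = 0)
    (hg : ∀ u, g (s false u) + g (s true u) = 2 * g u) (v : V) : g v ≤ 0 := by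
  have : Nonempty V := ⟨v⟩
  obtain ⟨m, hm⟩ := Finite.exists_max g
  have key : ∀ w, Relation.ReflTransGen (fun u w : V => s false u = w ∨ s true u = w) m w →
      g w = g m := by
    intro w hw
    induction hw with
    | refl => rfl
    | @tail b c _ hbc ih =>
      have h0 := hm (s false b)
      have h1 := hm (s true b)
      have h2 := hg b
      rcases hbc with rfl | rfl <;> linarith
  have hv := hm v
  rcases hreach m with h | h
  · linarith [key d h]
  · linarith [key dbar h]

/-- The matrix of the Kirchhoff operator on vertex vectors: inflow along both edges of each
non-sink vertex, minus twice the vertex value. -/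
def kirchhoffMatrix {V : Type} [DecidableEq V] (s : Bool → V → V) (d dbar : V) :
    Matrix {v : V // v ≠ d ∧ v ≠ dbar} {v : V // v ≠ d ∧ v ≠ dbar} ℝ :=
  fun v u => (∑ b : Bool, if s b u.1 = v.1 then 1 else 0) - if v = u then 2 else 0

theorem kirchhoffMatrix_mulVec {V : Type} [Fintype V] [DecidableEq V] (s : Bool → V → V)
    (d dbar : V) (x : {v : V // v ≠ d ∧ v ≠ dbar} → ℝ) (v : {v : V // v ≠ d ∧ v ≠ dbar}) :
    (kirchhoffMatrix s d dbar).mulVec x v =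
      (∑ u : {v : V // v ≠ d ∧ v ≠ dbar}, ∑ b : Bool, if s b u.1 = v.1 then x u else 0)
        - 2 * x v := by
  simp only [Matrix.mulVec, dotProduct, kirchhoffMatrix, Fintype.sum_bool]
  simp [sub_mul, add_mul, Finset.sum_sub_distrib]

theorem kirchhoffMatrix_vecMul {V : Type} [Fintype V] [DecidableEq V] (s : Bool → V → V)
    (d dbar : V) (g : V → ℝ) (hd : g d = 0) (hb : g dbar = 0)
    (u : {v : V // v ≠ d ∧ v ≠ dbar}) :
    Matrix.vecMul (fun v : {v : V // v ≠ d ∧ v ≠ dbar} => g v.1) (kirchhoffMatrix s d dbar) u =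
      g (s false u.1) + g (s true u.1) - 2 * g u.1 := by
  have h : ∀ w : V,
      (∑ v : {v : V // v ≠ d ∧ v ≠ dbar}, if w = v.1 then g v.1 else 0) = g w := by
    intro w
    by_cases hw : w ≠ d ∧ w ≠ dbar
    · rw [Finset.sum_eq_single ⟨w, hw⟩]
      · simp
      · intro v _ hv
        exact if_neg fun e => hv (Subtype.ext e.symm)
      · simp
    · have hgw : g w = 0 := by
        by_cases h1 : w = d
        · rw [h1, hd]
        · by_cases h2 : w = dbar
          · rw [h2, hb]
          · exact absurd ⟨h1, h2⟩ hw
      rw [hgw]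
      refine Finset.sum_eq_zero fun v _ => if_neg ?_
      rintro rfl
      exact hw v.2
  rw [← h (s false u.1), ← h (s true u.1)]
  simp only [Matrix.vecMul, dotProduct, kirchhoffMatrix, Fintype.sum_bool]
  simp [mul_sub, mul_add, Finset.sum_sub_distrib, Finset.sum_add_distrib]
  ring

theorem kirchhoffMatrix_det_ne_zero {V : Type} [Fintype V] [DecidableEq V] (s : Bool → V → V)
    (d dbar : V)
    (hd0 : s false d = d) (hd1 : s true d = d)
    (hb0 : s false dbar = dbar) (hb1 : s true dbar = dbar)
    (hreach : ∀ v : V,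
      Relation.ReflTransGen (fun u w : V => s false u = w ∨ s true u = w) v d ∨
      Relation.ReflTransGen (fun u w : V => s false u = w ∨ s true u = w) v dbar) :
    (kirchhoffMatrix s d dbar).det ≠ 0 := by
  intro hdet
  obtain ⟨y, hy, hyM⟩ := Matrix.exists_vecMul_eq_zero_iff.2 hdet
  let g : V → ℝ := fun w => if h : w ≠ d ∧ w ≠ dbar then y ⟨w, h⟩ else 0
  have hgy : (fun v : {v : V // v ≠ d ∧ v ≠ dbar} => g v.1) = y := by
    funext v
    exact dif_pos v.2
  have hgd : g d = 0 := by simp [g]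
  have hgb : g dbar = 0 := by simp [g]
  have hmean : ∀ u, g (s false u) + g (s true u) = 2 * g u := by
    intro u
    by_cases h1 : u = d
    · subst h1; rw [hd0, hd1]; ring
    by_cases h2 : u = dbar
    · subst h2; rw [hb0, hb1]; ring
    have h := kirchhoffMatrix_vecMul s d dbar g hgd hgb ⟨u, h1, h2⟩
    rw [hgy, hyM, Pi.zero_apply] at h
    linarith
  apply hy
  funext v
  have hle := nonpos_of_mean_of_reach s d dbar hreach g hgd hgb hmean v.1
  have hge := nonpos_of_mean_of_reach s d dbar hreach (fun w => -g w) (by simp [hgd])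
    (by simp [hgb]) (fun u => by linarith [hmean u]) v.1
  rw [← hgy, Pi.zero_apply]
  linarith

/-- Let `(G, o, d, d̄)` be an S-Arrival instance and set
`V' = V ∖ {d, d̄}`. For any target `t ∈ V` and any parity vector `p ∈ {0,1}^{V'}`
(encoded by `p : V' → Bool`), there is exactly one real vector `f`, indexed by the
edges `(v, s0 v)` and `(v, s1 v)` with `v ∈ V'`, satisfying Kirchhoff's law (with one
unit emitted at `o` and absorbed at `t`) at every `v ∈ V'` and the parity condition
`f (v, s0 v) - f (v, s1 v) = p v` at every `v ∈ V'`. -/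
theorem unique_real_flow_with_given_parity_and_target
    {V : Type} [Fintype V] [DecidableEq V] (s : Bool → V → V) (o d dbar : V)
    (hne : d ≠ dbar)
    (hd0 : s false d = d) (hd1 : s true d = d)
    (hb0 : s false dbar = dbar) (hb1 : s true dbar = dbar)
    (hreach : ∀ v : V,
      Relation.ReflTransGen (fun u w : V => s false u = w ∨ s true u = w) v d ∨
      Relation.ReflTransGen (fun u w : V => s false u = w ∨ s true u = w) v dbar)
    (t : V) (p : {v : V // v ≠ d ∧ v ≠ dbar} → Bool) :
    ∃! f : {v : V // v ≠ d ∧ v ≠ dbar} → Bool → ℝ,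
      (∀ v : {v : V // v ≠ d ∧ v ≠ dbar},
        ((∑ u : {v : V // v ≠ d ∧ v ≠ dbar}, ∑ b : Bool, if s b u.1 = v.1 then f u b else 0)
            - (f v false + f v true))
          = (if v.1 = t then 1 else 0) - (if v.1 = o then 1 else 0)) ∧
      (∀ v : {v : V // v ≠ d ∧ v ≠ dbar},
        f v false - f v true = if p v then 1 else 0) := by
  have hdet := kirchhoffMatrix_det_ne_zero s d dbar hd0 hd1 hb0 hb1 hreach
  have hunit : IsUnit (kirchhoffMatrix s d dbar) :=
    (Matrix.isUnit_iff_isUnit_det _).2 hdet.isUnit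
  let q : {v : V // v ≠ d ∧ v ≠ dbar} → ℝ := fun v => if p v then 1 else 0
  let r : {v : V // v ≠ d ∧ v ≠ dbar} → ℝ := fun v =>
    (if v.1 = t then 1 else 0) - (if v.1 = o then 1 else 0)
      - (∑ u : {v : V // v ≠ d ∧ v ≠ dbar}, if s false u.1 = v.1 then q u else 0) + q v
  have hiff : ∀ f : {v : V // v ≠ d ∧ v ≠ dbar} → Bool → ℝ,
      (∀ v, f v false - f v true = q v) →
      ((∀ v : {v : V // v ≠ d ∧ v ≠ dbar},
        ((∑ u : {v : V // v ≠ d ∧ v ≠ dbar}, ∑ b : Bool, if s b u.1 = v.1 then f u b else 0)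
            - (f v false + f v true))
          = (if v.1 = t then 1 else 0) - (if v.1 = o then 1 else 0)) ↔
        (kirchhoffMatrix s d dbar).mulVec (fun v => f v true) = r) := by
    intro f hf
    rw [funext_iff]
    refine forall_congr' fun v => ?_
    have hsum : (∑ u : {v : V // v ≠ d ∧ v ≠ dbar}, ∑ b : Bool,
          if s b u.1 = v.1 then f u b else 0) =
        (∑ u : {v : V // v ≠ d ∧ v ≠ dbar}, ∑ b : Bool, if s b u.1 = v.1 then f u true else 0)
          + ∑ u : {v : V // v ≠ d ∧ v ≠ dbar}, if s false u.1 = v.1 then q u else 0 := by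
      rw [← Finset.sum_add_distrib]
      refine Finset.sum_congr rfl fun u _ => ?_
      rw [Fintype.sum_bool, Fintype.sum_bool, ← hf u]
      split_ifs <;> ring
    rw [kirchhoffMatrix_mulVec, hsum]
    have hv := hf v
    simp only [r]
    constructor <;> intro h <;> linarith
  obtain ⟨x, hx⟩ := Matrix.mulVec_surjective_iff_isUnit.2 hunit r
  refine ⟨fun v b => x v + if b then 0 else q v, ⟨?_, ?_⟩, ?_⟩
  · exact (hiff _ (by simp)).2 (by simpa using hx)
  · simp [q]
  · rintro f ⟨hk, hp⟩
    have hfx : (fun v => f v true) = x :=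
      Matrix.mulVec_injective_iff_isUnit.2 hunit (((hiff f hp).1 hk).trans hx.symm)
    funext v b
    have hv : f v false - f v true = q v := hp v
    rw [← hfx]
    cases b
    · simp only [Bool.false_eq_true, if_false]
      linarith
    · simp
end

section
/- Let G=(V,E,s0,s1) be a switch graph and let d,d̄ ∈ V be distinct vertices such that from every vertex of V there is a directed path along edges of E to d or to d̄. Then there exists exactly one function λ : V → ℝ with λ(d) = 1, λ(d̄) = 0, and λ(v) = (λ(s0(v)) + λ(s1(v)))/2 for every v ∈ V∖{d,d̄}. -/
/-- Maximum principle: a function that is harmonic off `{d, e}` and nonpositive at `d` and `e`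
is nonpositive everywhere, provided every vertex reaches `d` or `e`. -/
theorem harmonic_nonpos {V : Type} [Fintype V] (s : Bool → V → V) (d e : V)
    (hreach : ∀ v : V,
      Relation.ReflTransGen (fun u w : V => s false u = w ∨ s true u = w) v d ∨
      Relation.ReflTransGen (fun u w : V => s false u = w ∨ s true u = w) v e)
    (l : V → ℝ) (hd : l d ≤ 0) (he : l e ≤ 0)
    (hl : ∀ v : V, v ≠ d → v ≠ e → l v = (l (s false v) + l (s true v)) / 2) (v : V) :
    l v ≤ 0 := by
  have : Nonempty V := ⟨d⟩
  obtain ⟨m, hm⟩ := Finite.exists_max l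
  have key : ∀ t : V, l t ≤ 0 →
      Relation.ReflTransGen (fun u w : V => s false u = w ∨ s true u = w) m t → l m ≤ 0 := by
    intro t ht h
    have aux : ∀ u : V,
        Relation.ReflTransGen (fun u w : V => s false u = w ∨ s true u = w) u t →
          l u = l m → l m ≤ 0 := by
      intro u hu
      induction hu using Relation.ReflTransGen.head_induction_on with
      | refl => intro h; exact h ▸ ht
      | @head a c hac _ ih =>
        intro ha
        by_cases had : a = d
        · subst had; exact ha ▸ hd
        by_cases hae : a = e
        · subst hae; exact ha ▸ he
        have h0 := hm (s false a)
        have h1 := hm (s true a)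
        have h2 := hl a had hae
        rcases hac with rfl | rfl <;> exact ih (by linarith)
    exact aux m h rfl
  exact (hm v).trans ((hreach m).elim (key d hd) (key e he))

/-- The identity at `d` and `e`, and the Laplacian of the switch graph elsewhere. -/
noncomputable def dirichletOperator {V : Type} [DecidableEq V] (s : Bool → V → V) (d e : V) :
    (V → ℝ) →ₗ[ℝ] (V → ℝ) where
  toFun l v := if v = d ∨ v = e then l v else l v - (l (s false v) + l (s true v)) / 2
  map_add' l l' := by
    funext v
    simp only [Pi.add_apply]
    split_ifs <;> ring
  map_smul' c l := by
    funext v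
    simp only [Pi.smul_apply, smul_eq_mul, RingHom.id_apply]
    split_ifs <;> ring

theorem dirichletOperator_apply {V : Type} [DecidableEq V] (s : Bool → V → V) (d e : V)
    (l : V → ℝ) (v : V) :
    dirichletOperator s d e l v =
      if v = d ∨ v = e then l v else l v - (l (s false v) + l (s true v)) / 2 := rfl

theorem dirichletOperator_injective {V : Type} [Fintype V] [DecidableEq V] (s : Bool → V → V)
    (d e : V)
    (hreach : ∀ v : V,
      Relation.ReflTransGen (fun u w : V => s false u = w ∨ s true u = w) v d ∨
      Relation.ReflTransGen (fun u w : V => s false u = w ∨ s true u = w) v e) :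
    Function.Injective (dirichletOperator s d e) := by
  have nonpos : ∀ l : V → ℝ, dirichletOperator s d e l = 0 → ∀ v, l v ≤ 0 := by
    intro l hl
    have h : ∀ v, (if v = d ∨ v = e then l v
        else l v - (l (s false v) + l (s true v)) / 2) = 0 := congrFun hl
    refine harmonic_nonpos s d e hreach l ?_ ?_ fun v hvd hve => ?_
    · simpa using (h d).le
    · simpa using (h e).le
    · have hv := h v
      rw [if_neg (by tauto)] at hv
      linarith
  rw [injective_iff_map_eq_zero]
  intro l hl
  funext v
  have h := nonpos (-l) (by rw [map_neg, hl, neg_zero]) v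
  rw [Pi.neg_apply] at h
  exact le_antisymm (nonpos l hl v) (by simpa using h)

/-- Let `G = (V, E, s0, s1)` be a switch graph and `d ≠ d̄` vertices
such that from every vertex there is a directed path along edges of `E` to `d` or to
`d̄`. Then there is exactly one function `λ : V → ℝ` with `λ d = 1`, `λ d̄ = 0`, and
`λ v = (λ (s0 v) + λ (s1 v)) / 2` for every `v ∈ V ∖ {d, d̄}`. -/
theorem unique_harmonic_values_on_switch_graph
    {V : Type} [Fintype V] [DecidableEq V] (s : Bool → V → V) (d dbar : V)
    (hne : d ≠ dbar)
    (hreach : ∀ v : V,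
      Relation.ReflTransGen (fun u w : V => s false u = w ∨ s true u = w) v d ∨
      Relation.ReflTransGen (fun u w : V => s false u = w ∨ s true u = w) v dbar) :
    ∃! lam : V → ℝ,
      lam d = 1 ∧ lam dbar = 0 ∧
        ∀ v : V, v ≠ d → v ≠ dbar → lam v = (lam (s false v) + lam (s true v)) / 2 := by
  have equiv : ∀ l : V → ℝ,
      (l d = 1 ∧ l dbar = 0 ∧
        ∀ v : V, v ≠ d → v ≠ dbar → l v = (l (s false v) + l (s true v)) / 2) ↔
      dirichletOperator s d dbar l = Pi.single d 1 := by
    intro l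
    constructor
    · rintro ⟨h1, h0, h⟩
      funext v
      rw [dirichletOperator_apply]
      by_cases hvd : v = d
      · subst hvd; simp [h1]
      by_cases hve : v = dbar
      · subst hve; simp [h0, hvd]
      simp [hvd, hve, ← h v hvd hve]
    · intro h
      have hv : ∀ v, _ = _ := congrFun h
      simp only [dirichletOperator_apply] at hv
      refine ⟨by simpa using hv d, by simpa [hne.symm] using hv dbar, fun v hvd hve => ?_⟩
      simpa [hvd, hve, sub_eq_zero] using hv v
  have inj := dirichletOperator_injective s d dbar hreach
  obtain ⟨l, hl⟩ := LinearMap.injective_iff_surjective.mp inj (Pi.single d 1)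
  exact ⟨l, (equiv l).mpr hl, fun l' hl' => inj (((equiv l').mp hl').trans hl.symm)⟩
end

section
/- Let (G,o,d,d̄) be an S-Arrival instance, and consider the run of the train from o, which stops when the train first reaches d or d̄. If f and g are partial run profiles of this run such that their end-vertices coincide (v_f = v_g) and their parity vectors coincide ((p_f)_v = (p_g)_v for every v ∈ V∖{d,d̄}), then f = g. -/
/-- Configuration of the run of the train from `o` in an S-Arrival instance after `k`
steps; the process stops when the train first reaches `d` or `dbar`. -/
def runStateS {V : Type} [DecidableEq V] (s : Bool → V → V) (o d dbar : V) :
    ℕ → V × (V → Bool)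
  | 0 => (o, fun _ => false)
  | k + 1 =>
      if (runStateS s o d dbar k).1 = d ∨ (runStateS s o d dbar k).1 = dbar then
        runStateS s o d dbar k
      else trainStep s (runStateS s o d dbar k)

/-- The partial run profile after `k` steps of the run of the train from `o` in an
S-Arrival instance (stopping at `d` or `dbar`). -/
def runProfileS {V : Type} [DecidableEq V] (s : Bool → V → V) (o d dbar : V) :
    ℕ → V → Bool → ℕ
  | 0 => fun _ _ => 0
  | k + 1 =>
      if (runStateS s o d dbar k).1 = d ∨ (runStateS s o d dbar k).1 = dbar then
        runProfileS s o d dbar k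
      else fun v b =>
        runProfileS s o d dbar k v b +
          if v = (runStateS s o d dbar k).1 ∧
              b = (runStateS s o d dbar k).2 (runStateS s o d dbar k).1
          then 1 else 0

section TrainRun

variable {V : Type} [DecidableEq V] {s : Bool → V → V} {o d dbar : V}

/-- Once the train has reached `d` or `dbar`, its configuration and profile no longer change. -/
theorem run_constant_of_stopped {i j : ℕ} (hij : i ≤ j)
    (h : (runStateS s o d dbar i).1 = d ∨ (runStateS s o d dbar i).1 = dbar) :
    runStateS s o d dbar j = runStateS s o d dbar i ∧
      runProfileS s o d dbar j = runProfileS s o d dbar i := by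
  induction j, hij using Nat.le_induction with
  | base => exact ⟨rfl, rfl⟩
  | succ j _ ih =>
    have hj : (runStateS s o d dbar j).1 = d ∨ (runStateS s o d dbar j).1 = dbar := by
      rwa [ih.1]
    simpa only [runStateS, runProfileS, if_pos hj] using ih

theorem runProfileS_mono (v : V) (b : Bool) :
    Monotone fun k => runProfileS s o d dbar k v b := by
  refine monotone_nat_of_le_succ fun k => ?_
  simp only [runProfileS]
  split_ifs with h
  · exact le_rfl
  · exact Nat.le_add_right _ _

/-- An edge whose traversal count grows between two times is traversed at a time in between. -/
theorem exists_traversal_of_runProfileS_lt {i j : ℕ} (hij : i ≤ j) {v : V} {b : Bool}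
    (h : runProfileS s o d dbar i v b < runProfileS s o d dbar j v b) :
    ∃ m, i ≤ m ∧ m < j ∧ v ≠ d ∧ v ≠ dbar ∧ (runStateS s o d dbar (m + 1)).1 = s b v := by
  induction j, hij using Nat.le_induction with
  | base => exact absurd h (lt_irrefl _)
  | succ j hj ih =>
    by_cases hlt : runProfileS s o d dbar i v b < runProfileS s o d dbar j v b
    · obtain ⟨m, him, hmj, hm⟩ := ih hlt
      exact ⟨m, him, hmj.trans j.lt_succ_self, hm⟩
    · by_cases hs : (runStateS s o d dbar j).1 = d ∨ (runStateS s o d dbar j).1 = dbar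
      · rw [runProfileS, if_pos hs] at h
        exact absurd h hlt
      · rw [runProfileS, if_neg hs] at h
        by_cases hv : v = (runStateS s o d dbar j).1 ∧
            b = (runStateS s o d dbar j).2 (runStateS s o d dbar j).1
        · obtain ⟨rfl, rfl⟩ := hv
          refine ⟨j, hj, j.lt_succ_self, fun h => hs (.inl h), fun h => hs (.inr h), ?_⟩
          rw [runStateS, if_neg hs, trainStep]
        · rw [if_neg hv, add_zero] at h
          exact absurd h hlt

/-- Departing from a vertex strictly increases the traversal count of one of its edges. -/
theorem exists_runProfileS_lt {i m j : ℕ} (him : i ≤ m) (hmj : m < j)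
    (hs : ¬((runStateS s o d dbar m).1 = d ∨ (runStateS s o d dbar m).1 = dbar)) :
    ∃ b, runProfileS s o d dbar i (runStateS s o d dbar m).1 b
      < runProfileS s o d dbar j (runStateS s o d dbar m).1 b := by
  refine ⟨(runStateS s o d dbar m).2 (runStateS s o d dbar m).1, ?_⟩
  refine (runProfileS_mono _ _ him).trans_lt
    (lt_of_lt_of_le ?_ (runProfileS_mono _ _ (Nat.succ_le_of_lt hmj)))
  simp [runProfileS, if_neg hs]

/-- A train that has not yet stopped never returns to the same vertex with the same parities. -/
theorem stopped_of_end_vertex_eq_of_parity_eq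
    (hreach : ∀ v : V,
      Relation.ReflTransGen (fun u w : V => s false u = w ∨ s true u = w) v d ∨
      Relation.ReflTransGen (fun u w : V => s false u = w ∨ s true u = w) v dbar)
    {k₁ k₂ : ℕ} (hlt : k₁ < k₂)
    (hend : (runStateS s o d dbar k₁).1 = (runStateS s o d dbar k₂).1)
    (hpar : ∀ v : V, v ≠ d → v ≠ dbar →
      (runProfileS s o d dbar k₁ v false : ℤ) - (runProfileS s o d dbar k₁ v true : ℤ)
        = (runProfileS s o d dbar k₂ v false : ℤ) - (runProfileS s o d dbar k₂ v true : ℤ)) :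
    (runStateS s o d dbar k₁).1 = d ∨ (runStateS s o d dbar k₁).1 = dbar := by
  by_contra hs
  have hrun : ∀ m ≤ k₂,
      ¬((runStateS s o d dbar m).1 = d ∨ (runStateS s o d dbar m).1 = dbar) := by
    intro m hm h
    apply hs
    rwa [hend, (run_constant_of_stopped hm h).1]
  let P : V → Prop := fun v =>
    ∃ b, runProfileS s o d dbar k₁ v b < runProfileS s o d dbar k₂ v b
  have hstart : P (runStateS s o d dbar k₁).1 := exists_runProfileS_lt le_rfl hlt hs
  have hP : ∀ v, P v → v ≠ d ∧ v ≠ dbar := by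
    rintro v ⟨b, hb⟩
    obtain ⟨_, -, -, hvd, hvb, -⟩ := exists_traversal_of_runProfileS_lt hlt.le hb
    exact ⟨hvd, hvb⟩
  have hsucc : ∀ v b, P v → P (s b v) := by
    intro v b hv
    have hb : runProfileS s o d dbar k₁ v b < runProfileS s o d dbar k₂ v b := by
      have hv' := hpar v (hP v hv).1 (hP v hv).2
      obtain ⟨c, hc⟩ := hv
      cases b <;> cases c <;> omega
    obtain ⟨m, hm₁, hm₂, -, -, hm⟩ := exists_traversal_of_runProfileS_lt hlt.le hb
    rw [← hm]
    rcases (Nat.succ_le_of_lt hm₂).eq_or_lt with h | h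
    · rw [← Nat.succ_eq_add_one, h, ← hend]
      exact hstart
    · exact exists_runProfileS_lt (hm₁.trans m.le_succ) h (hrun _ h.le)
  have hclosed : ∀ w, Relation.ReflTransGen (fun u w : V => s false u = w ∨ s true u = w)
      (runStateS s o d dbar k₁).1 w → P w := by
    intro w hw
    induction hw with
    | refl => exact hstart
    | tail _ h ih =>
      rcases h with rfl | rfl
      · exact hsucc _ _ ih
      · exact hsucc _ _ ih
  rcases hreach (runStateS s o d dbar k₁).1 with h | h
  · exact (hP _ (hclosed _ h)).1 rfl
  · exact (hP _ (hclosed _ h)).2 rfl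

end TrainRun

/-- In an S-Arrival instance `(G, o, d, d̄)`, if two partial run
profiles of the run of the train from `o` (which stops when the train first reaches
`d` or `d̄`) have the same end-vertex and the same parity vector on `V ∖ {d, d̄}`,
then they are equal. -/
theorem partial_run_profile_determined_by_end_vertex_and_parity
    {V : Type} [Fintype V] [DecidableEq V] (s : Bool → V → V) (o d dbar : V)
    (hne : d ≠ dbar)
    (hd0 : s false d = d) (hd1 : s true d = d)
    (hb0 : s false dbar = dbar) (hb1 : s true dbar = dbar)
    (hreach : ∀ v : V,
      Relation.ReflTransGen (fun u w : V => s false u = w ∨ s true u = w) v d ∨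
      Relation.ReflTransGen (fun u w : V => s false u = w ∨ s true u = w) v dbar)
    (k₁ k₂ : ℕ)
    (hend : (runStateS s o d dbar k₁).1 = (runStateS s o d dbar k₂).1)
    (hpar : ∀ v : V, v ≠ d → v ≠ dbar →
      (runProfileS s o d dbar k₁ v false : ℤ) - (runProfileS s o d dbar k₁ v true : ℤ)
        = (runProfileS s o d dbar k₂ v false : ℤ) - (runProfileS s o d dbar k₂ v true : ℤ)) :
    runProfileS s o d dbar k₁ = runProfileS s o d dbar k₂ := by
  rcases lt_trichotomy k₁ k₂ with h | rfl | h
  · exact (run_constant_of_stopped h.le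
      (stopped_of_end_vertex_eq_of_parity_eq hreach h hend hpar)).2.symm
  · rfl
  · exact (run_constant_of_stopped h.le
      (stopped_of_end_vertex_eq_of_parity_eq hreach h hend.symm
        fun v hd hb => (hpar v hd hb).symm)).2
end

section
/- If the run of the train from o to d terminates after exactly R steps, then the configurations of the process at steps 0,1,…,R−1 — where a configuration consists of the train's position together with the current switch setting (s0 or s1) of every vertex — are pairwise distinct; consequently R ≤ n·2^n, where n = |V|. -/
/-- Runs that agree at two times agree after any equal number of further steps. -/
theorem runState_add_eq_of_eq {V : Type} [DecidableEq V] {s : Bool → V → V} {o d : V}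
    {i j : ℕ} (h : runState s o d i = runState s o d j) (m : ℕ) :
    runState s o d (i + m) = runState s o d (j + m) := by
  induction m with
  | zero => exact h
  | succ m ih => rw [← Nat.add_assoc, ← Nat.add_assoc, runState, runState, ih]

/-- A configuration cannot recur before the destination is first reached. -/
theorem runState_ne_of_lt {V : Type} [DecidableEq V] {s : Bool → V → V} {o d : V}
    {R : ℕ} (hR : (runState s o d R).1 = d)
    (hmin : ∀ k : ℕ, k < R → (runState s o d k).1 ≠ d) {i j : ℕ} (hij : i < j) (hj : j < R) :
    runState s o d i ≠ runState s o d j := by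
  intro h
  have hrec := runState_add_eq_of_eq h (R - j)
  rw [Nat.add_sub_cancel' hj.le] at hrec
  exact hmin (i + (R - j)) (by omega) (hrec ▸ hR)

/-- If the run of the train from `o` to `d` terminates after exactly
`R` steps, then the configurations (position together with all current switch settings)
at steps `0, 1, …, R - 1` are pairwise distinct; consequently `R ≤ n * 2 ^ n` where
`n = |V|`. -/
theorem configurations_pairwise_distinct_and_run_length_bound
    {V : Type} [Fintype V] [DecidableEq V] (s : Bool → V → V) (o d : V)
    (hd0 : s false d = d) (hd1 : s true d = d)
    (R : ℕ) (hR : (runState s o d R).1 = d) (hmin : ∀ k : ℕ, k < R → (runState s o d k).1 ≠ d) :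
    (∀ i j : ℕ, i < R → j < R → runState s o d i = runState s o d j → i = j) ∧
    R ≤ Fintype.card V * 2 ^ Fintype.card V := by
  have hinj : ∀ i j : ℕ, i < R → j < R → runState s o d i = runState s o d j → i = j := by
    intro i j hi hj h
    rcases lt_trichotomy i j with hij | hij | hij
    · exact absurd h (runState_ne_of_lt hR hmin hij hj)
    · exact hij
    · exact absurd h.symm (runState_ne_of_lt hR hmin hij hi)
  refine ⟨hinj, ?_⟩
  have hcard := Fintype.card_le_of_injective (fun k : Fin R => runState s o d k)
    fun a b h => Fin.ext (hinj a b a.2 b.2 h)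
  simpa using hcard
end
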